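/- arXiv:1603.04559 — 2 statements merged into one kernel-verified Lean document; each statement's English description precedes it below -/
import Mathlib

section
/- Let H be a finite simple graph, let k ∈ {0,1}, let a be a vertex of H of degree two, let e₁, e₂ be edges of H (not necessarily distinct), and let G = H ∘ (e₁,e₂,a). If p is a real number such that φ(H − W) ≤ p for every set W of edges of H with |W| = k, then φ(G − W′) ≤ p + 1 for every set W′ of edges of G with |W′| = k. -/
open SimpleGraph

/-- The minimum size of a feedback vertex set of `G`. -/
noncomputable def phi {V : Type} (G : SimpleGraph V) : ℕ :=
  sInf {n : ℕ | ∃ S : Finset V, S.card = n ∧ (G.induce ((S : Set V)ᶜ)).IsAcyclic}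

/-- The graph obtained from `H` by subdividing the edge `uv` once: delete the edge `uv`
and add a new vertex (`none`) adjacent exactly to `u` and `v`. -/
def subdivideEdge {V : Type} (H : SimpleGraph V) (u v : V) : SimpleGraph (Option V) :=
  SimpleGraph.fromRel (fun x y =>
    (∃ p q : V, x = some p ∧ y = some q ∧ H.Adj p q ∧ s(p, q) ≠ s(u, v)) ∨
    (x = none ∧ (y = some u ∨ y = some v)))

/-- `a` has degree exactly two in `H`. -/
def HasDegreeTwo {V : Type} (H : SimpleGraph V) (a : V) : Prop :=
  ∃ x y : V, x ≠ y ∧ H.Adj a x ∧ H.Adj a y ∧ ∀ z : V, H.Adj a z → z = x ∨ z = y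

/-- The operation `∘` applied with two distinct edges `u₁v₁`, `u₂v₂` and a degree-two vertex `a`:
subdivide both edges (new vertices `inr 0`, `inr 1`), then add a new vertex `inr 2` adjacent to
`a` and the two subdivision vertices. -/
def circOpTwo {V : Type} (H : SimpleGraph V) (u₁ v₁ u₂ v₂ a : V) : SimpleGraph (V ⊕ Fin 3) :=
  SimpleGraph.fromRel (fun x y =>
    (∃ p q : V, x = Sum.inl p ∧ y = Sum.inl q ∧ H.Adj p q ∧
      s(p, q) ≠ s(u₁, v₁) ∧ s(p, q) ≠ s(u₂, v₂)) ∨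
    (x = Sum.inr 0 ∧ (y = Sum.inl u₁ ∨ y = Sum.inl v₁)) ∨
    (x = Sum.inr 1 ∧ (y = Sum.inl u₂ ∨ y = Sum.inl v₂)) ∨
    (x = Sum.inr 2 ∧ (y = Sum.inl a ∨ y = Sum.inr 0 ∨ y = Sum.inr 1)))

/-- The operation `∘` applied with `e₁ = e₂ = uv` and a degree-two vertex `a`: subdivide the
edge `uv` twice (replacing it by the path `u, inr 0, inr 1, v`), then add a new vertex `inr 2`
adjacent to `a` and the two subdivision vertices. -/
def circOpOne {V : Type} (H : SimpleGraph V) (u v a : V) : SimpleGraph (V ⊕ Fin 3) :=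
  SimpleGraph.fromRel (fun x y =>
    (∃ p q : V, x = Sum.inl p ∧ y = Sum.inl q ∧ H.Adj p q ∧ s(p, q) ≠ s(u, v)) ∨
    (x = Sum.inr 0 ∧ (y = Sum.inl u ∨ y = Sum.inr 1)) ∨
    (x = Sum.inr 1 ∧ y = Sum.inl v) ∨
    (x = Sum.inr 2 ∧ (y = Sum.inl a ∨ y = Sum.inr 0 ∨ y = Sum.inr 1)))

/-- `G` is obtained from `H` by one application of the operation `∘` at the degree-two
vertex `a`, using two (not necessarily distinct) edges of `H`. -/
def IsCircOp {V : Type} (H : SimpleGraph V) (a : V) (G : SimpleGraph (V ⊕ Fin 3)) : Prop :=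
  (∃ u₁ v₁ u₂ v₂ : V, H.Adj u₁ v₁ ∧ H.Adj u₂ v₂ ∧ s(u₁, v₁) ≠ s(u₂, v₂) ∧
      G = circOpTwo H u₁ v₁ u₂ v₂ a) ∨
  (∃ u v : V, H.Adj u v ∧ G = circOpOne H u v a)

/-- Membership (up to isomorphism) in the family `F_{i,j}`. -/
inductive IsInF : ∀ (i j : ℕ) {V : Type}, SimpleGraph V → Prop
  | cycle (i : ℕ) (hi : 3 ≤ i) : IsInF i 0 (SimpleGraph.cycleGraph i)
  | k4 : IsInF 1 1 (⊤ : SimpleGraph (Fin 4))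
  | subdiv {i j : ℕ} {V : Type} {H : SimpleGraph V} {u v : V}
      (huv : H.Adj u v) (hH : IsInF i j H) : IsInF (i + 1) j (subdivideEdge H u v)
  | op {i j : ℕ} {V : Type} {H : SimpleGraph V} {a : V} {G : SimpleGraph (V ⊕ Fin 3)}
      (ha : HasDegreeTwo H a) (hG : IsCircOp H a G) (hH : IsInF i j H) : IsInF i (j + 1) G
  | iso {i j : ℕ} {V W : Type} {H : SimpleGraph V} {G : SimpleGraph W}
      (e : Nonempty (G ≃g H)) (hH : IsInF i j H) : IsInF i j G

/-- `G` is a graph obtained from `H` by repeatedly (possibly zero times) subdividing edges. -/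
inductive IsSubdivisionOf : ∀ {V : Type}, SimpleGraph V → ∀ {W : Type}, SimpleGraph W → Prop
  | refl {V : Type} (G : SimpleGraph V) : IsSubdivisionOf G G
  | step {V W : Type} {H : SimpleGraph V} {G : SimpleGraph W} {u v : W}
      (huv : G.Adj u v) (h : IsSubdivisionOf H G) : IsSubdivisionOf H (subdivideEdge G u v)

/-- `G` contains an induced subdivision of `H`: some induced subgraph of `G` is isomorphic
to a graph obtained from `H` by repeatedly subdividing edges. -/
def ContainsInducedSubdivision {V W : Type} (G : SimpleGraph V) (H : SimpleGraph W) : Prop :=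
  ∃ (s : Set V) (U : Type) (K : SimpleGraph U),
    IsSubdivisionOf H K ∧ Nonempty (G.induce s ≃g K)

/-- The family `𝓕`: members of `F_{4,2} ∪ F_{4,3}` of girth at least five, together with
members `H` of `F_{3,2} ∪ F_{3,3}` having an edge `e` such that `H − e` has girth at least
five. -/
def InFamilyF {W : Type} (H : SimpleGraph W) : Prop :=
  ((IsInF 4 2 H ∨ IsInF 4 3 H) ∧ 5 ≤ H.girth) ∨
  ((IsInF 3 2 H ∨ IsInF 3 3 H) ∧ ∃ e ∈ H.edgeSet, 5 ≤ (H.deleteEdges {e}).girth)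

/-- `G` contains two vertex-disjoint cycles, each of length less than five. -/
def HasTwoDisjointShortCycles {V : Type} (G : SimpleGraph V) : Prop :=
  ∃ (u v : V) (c₁ : G.Walk u u) (c₂ : G.Walk v v), c₁.IsCycle ∧ c₂.IsCycle ∧
    c₁.length < 5 ∧ c₂.length < 5 ∧ ∀ x : V, x ∈ c₁.support → x ∉ c₂.support

def Core {V : Type} (G : SimpleGraph V) (A : Set V) : Prop :=
  A.Nonempty ∧ ∀ v ∈ A, ∀ z, ∃ x ∈ A, x ≠ z ∧ G.Adj v x

lemma not_core_univ {V : Type} [Finite V] (G : SimpleGraph V) (h : G.IsAcyclic) :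
    ¬ Core G Set.univ := by
  rintro ⟨⟨v0, -⟩, hc⟩
  have : Nonempty V := ⟨v0⟩
  obtain ⟨u, v, p, hp, hmax⟩ := Walk.exists_isPath_forall_isPath_length_le_length G
  obtain ⟨x, -, hx, hadj⟩ := hc u trivial p.snd
  refine hx (h.eq_snd_of_adj_start hp hadj ?_)
  by_contra hn
  have := hmax _ _ (Walk.cons hadj.symm p) (hp.cons hn)
  simp at this

lemma core_of_cycle {V : Type} (G : SimpleGraph V) {v : V} (c : G.Walk v v) (hc : c.IsCycle) :
    Core G {x | x ∈ c.support} := by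
  refine ⟨⟨v, c.start_mem_support⟩, fun w hw z => ?_⟩
  have h2 := hc.ncard_neighborSet_toSubgraph_eq_two hw
  obtain ⟨x, hx, hxz⟩ := Set.exists_ne_of_one_lt_ncard (by omega : 1 < (c.toSubgraph.neighborSet w).ncard) z
  refine ⟨x, ?_, hxz, ?_⟩
  · have := c.toSubgraph.edge_vert (Subgraph.Adj.symm hx)
    simpa using this
  · exact Subgraph.Adj.adj_sub hx

lemma acyclic_iff {V : Type} [Finite V] (G : SimpleGraph V) (s : Set V) :
    (G.induce s).IsAcyclic ↔ ∀ A ⊆ s, ¬ Core G A := by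
  constructor
  · rintro h A hA ⟨⟨v, hv⟩, hc⟩
    have h' : (G.induce A).IsAcyclic := h.embedding (SimpleGraph.induceHomOfLE G hA)
    refine not_core_univ _ h' ⟨⟨⟨v, hv⟩, trivial⟩, fun w _ z => ?_⟩
    obtain ⟨x, hx, hxz, hadj⟩ := hc w w.2 z
    exact ⟨⟨x, hx⟩, trivial, fun e => hxz (by rw [← e]), hadj⟩
  · intro h v c hc
    obtain ⟨⟨w, hw⟩, hcc⟩ := core_of_cycle _ c hc
    refine h (Subtype.val '' {x | x ∈ c.support}) (by simp) ⟨⟨_, w, hw, rfl⟩, ?_⟩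
    rintro _ ⟨y, hy, rfl⟩ z
    by_cases hz : z ∈ s
    · obtain ⟨x, hx, hxz, hadj⟩ := hcc y hy ⟨z, hz⟩
      exact ⟨x, ⟨x, hx, rfl⟩, fun e => hxz (Subtype.ext e), hadj⟩
    · obtain ⟨x, hx, hxz, hadj⟩ := hcc y hy y
      exact ⟨x, ⟨x, hx, rfl⟩, fun e => hz (e ▸ x.2), hadj⟩

lemma phi_le {V : Type} [Fintype V] (F : SimpleGraph (V ⊕ Fin 3)) (K : SimpleGraph V)
    (x : V ⊕ Fin 3) (h : ∀ A, x ∉ A → Core F A → Core K (Sum.inl ⁻¹' A)) :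
    phi F ≤ phi K + 1 := by
  classical
  obtain ⟨S, hS, hac⟩ : phi K ∈ {n : ℕ | ∃ S : Finset V, S.card = n ∧
      (K.induce ((S : Set V)ᶜ)).IsAcyclic} := by
    apply Nat.sInf_mem
    refine ⟨_, Finset.univ, rfl, ?_⟩
    rw [acyclic_iff]
    rintro A hA ⟨⟨v, hv⟩, -⟩
    simpa using hA hv
  rw [acyclic_iff] at hac
  set T : Finset (V ⊕ Fin 3) := insert x (S.image Sum.inl) with hT
  have hcard : T.card ≤ phi K + 1 := by
    rw [← hS]
    exact (Finset.card_insert_le _ _).trans (Nat.add_le_add_right Finset.card_image_le 1)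
  refine le_trans (Nat.sInf_le ⟨T, rfl, ?_⟩) hcard
  rw [acyclic_iff]
  intro A hA hc
  refine hac _ ?_ (h A ?_ hc)
  · intro v hv hvS
    exact hA hv (by simp only [hT, Finset.mem_coe, Finset.mem_insert, Finset.mem_image]; exact Or.inr ⟨v, hvS, rfl⟩)
  · intro hx
    exact hA hx (by simp [hT])

lemma two_ll {V : Type} (H : SimpleGraph V) (u₁ v₁ u₂ v₂ a p q : V) :
    (circOpTwo H u₁ v₁ u₂ v₂ a).Adj (Sum.inl p) (Sum.inl q) ↔
      H.Adj p q ∧ s(p, q) ≠ s(u₁, v₁) ∧ s(p, q) ≠ s(u₂, v₂) := by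
  have := H.ne_of_adj (a := p) (b := q)
  have := H.adj_comm p q
  simp [circOpTwo]
  grind

lemma two_0 {V : Type} (H : SimpleGraph V) (u₁ v₁ u₂ v₂ a : V) (x : V ⊕ Fin 3) :
    (circOpTwo H u₁ v₁ u₂ v₂ a).Adj (Sum.inr 0) x ↔
      x = Sum.inl u₁ ∨ x = Sum.inl v₁ ∨ x = Sum.inr 2 := by
  simp [circOpTwo]
  grind

lemma two_1 {V : Type} (H : SimpleGraph V) (u₁ v₁ u₂ v₂ a : V) (x : V ⊕ Fin 3) :
    (circOpTwo H u₁ v₁ u₂ v₂ a).Adj (Sum.inr 1) x ↔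
      x = Sum.inl u₂ ∨ x = Sum.inl v₂ ∨ x = Sum.inr 2 := by
  simp [circOpTwo]
  grind

lemma two_2 {V : Type} (H : SimpleGraph V) (u₁ v₁ u₂ v₂ a : V) (x : V ⊕ Fin 3) :
    (circOpTwo H u₁ v₁ u₂ v₂ a).Adj (Sum.inr 2) x ↔
      x = Sum.inl a ∨ x = Sum.inr 0 ∨ x = Sum.inr 1 := by
  simp [circOpTwo]
  grind

lemma one_ll {V : Type} (H : SimpleGraph V) (u v a p q : V) :
    (circOpOne H u v a).Adj (Sum.inl p) (Sum.inl q) ↔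
      H.Adj p q ∧ s(p, q) ≠ s(u, v) := by
  have := H.ne_of_adj (a := p) (b := q)
  have := H.adj_comm p q
  simp [circOpOne]
  grind

lemma one_0 {V : Type} (H : SimpleGraph V) (u v a : V) (x : V ⊕ Fin 3) :
    (circOpOne H u v a).Adj (Sum.inr 0) x ↔
      x = Sum.inl u ∨ x = Sum.inr 1 ∨ x = Sum.inr 2 := by
  simp [circOpOne]
  grind

lemma one_1 {V : Type} (H : SimpleGraph V) (u v a : V) (x : V ⊕ Fin 3) :
    (circOpOne H u v a).Adj (Sum.inr 1) x ↔
      x = Sum.inl v ∨ x = Sum.inr 0 ∨ x = Sum.inr 2 := by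
  simp [circOpOne]
  grind

lemma one_2 {V : Type} (H : SimpleGraph V) (u v a : V) (x : V ⊕ Fin 3) :
    (circOpOne H u v a).Adj (Sum.inr 2) x ↔
      x = Sum.inl a ∨ x = Sum.inr 0 ∨ x = Sum.inr 1 := by
  simp [circOpOne]
  grind

lemma core_two {V : Type} (F : SimpleGraph (V ⊕ Fin 3)) (K : SimpleGraph V) (A : Set (V ⊕ Fin 3))
    (u₁ v₁ u₂ v₂ : V) (hne : s(u₁, v₁) ≠ s(u₂, v₂)) (hA : Core F A)
    (hll : ∀ p q, F.Adj (Sum.inl p) (Sum.inl q) →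
      K.Adj p q ∧ s(p, q) ≠ s(u₁, v₁) ∧ s(p, q) ≠ s(u₂, v₂))
    (h0 : Sum.inr 0 ∈ A → Sum.inl u₁ ∈ A ∧ Sum.inl v₁ ∈ A ∧ K.Adj u₁ v₁ ∧
      ∀ p, F.Adj (Sum.inl p) (Sum.inr 0) → p = u₁ ∨ p = v₁)
    (h1 : Sum.inr 1 ∈ A → Sum.inl u₂ ∈ A ∧ Sum.inl v₂ ∈ A ∧ K.Adj u₂ v₂ ∧
      ∀ p, F.Adj (Sum.inl p) (Sum.inr 1) → p = u₂ ∨ p = v₂)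
    (h2 : Sum.inr 2 ∉ A) : Core K (Sum.inl ⁻¹' A) := by
  classical
  obtain ⟨⟨w, hw⟩, hc⟩ := hA
  refine ⟨?_, ?_⟩
  · rcases w with w | i
    · exact ⟨w, hw⟩
    · fin_cases i
      · exact ⟨u₁, (h0 hw).1⟩
      · exact ⟨u₂, (h1 hw).1⟩
      · exact absurd hw h2
  · intro p hp z
    obtain ⟨x, hx, hxz, hadj⟩ := hc _ hp
      (if s(p, z) = s(u₁, v₁) then Sum.inr 0 else if s(p, z) = s(u₂, v₂) then Sum.inr 1
        else Sum.inl z)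
    rcases x with q | i
    · refine ⟨q, hx, ?_, (hll _ _ hadj).1⟩
      have := hll _ _ hadj
      grind
    · fin_cases i
      · obtain ⟨hu, hv, hK, h⟩ := h0 hx
        have hK' := hK.symm
        rcases h p hadj with rfl | rfl
        · exact ⟨v₁, hv, by grind, hK⟩
        · exact ⟨u₁, hu, by grind, hK'⟩
      · obtain ⟨hu, hv, hK, h⟩ := h1 hx
        have hK' := hK.symm
        rcases h p hadj with rfl | rfl
        · exact ⟨v₂, hv, by grind, hK⟩
        · exact ⟨u₂, hu, by grind, hK'⟩
      · exact absurd hx h2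

lemma core_one {V : Type} (F : SimpleGraph (V ⊕ Fin 3)) (K : SimpleGraph V) (A : Set (V ⊕ Fin 3))
    (u v : V) (huv : u ≠ v) (hA : Core F A)
    (hll : ∀ p q, F.Adj (Sum.inl p) (Sum.inl q) → K.Adj p q ∧ s(p, q) ≠ s(u, v))
    (h0 : Sum.inr 0 ∈ A ∨ Sum.inr 1 ∈ A → Sum.inl u ∈ A ∧ Sum.inl v ∈ A ∧ K.Adj u v ∧
      (∀ p, F.Adj (Sum.inl p) (Sum.inr 0) → p = u) ∧
      (∀ p, F.Adj (Sum.inl p) (Sum.inr 1) → p = v))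
    (h2 : Sum.inr 2 ∉ A) : Core K (Sum.inl ⁻¹' A) := by
  classical
  obtain ⟨⟨w, hw⟩, hc⟩ := hA
  refine ⟨?_, ?_⟩
  · rcases w with w | i
    · exact ⟨w, hw⟩
    · fin_cases i
      · exact ⟨u, (h0 (Or.inl hw)).1⟩
      · exact ⟨u, (h0 (Or.inr hw)).1⟩
      · exact absurd hw h2
  · intro p hp z
    obtain ⟨x, hx, hxz, hadj⟩ := hc _ hp
      (if s(p, z) = s(u, v) then (if p = u then Sum.inr 0 else Sum.inr 1) else Sum.inl z)
    rcases x with q | i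
    · refine ⟨q, hx, ?_, (hll _ _ hadj).1⟩
      have := hll _ _ hadj
      grind
    · fin_cases i
      · obtain ⟨hu, hv, hK, h, h'⟩ := h0 (Or.inl hx)
        obtain rfl := h p hadj
        exact ⟨v, hv, by grind, hK⟩
      · obtain ⟨hu, hv, hK, h, h'⟩ := h0 (Or.inr hx)
        obtain rfl := h' p hadj
        exact ⟨u, hu, by grind, hK.symm⟩
      · exact absurd hx h2

lemma two_A {V : Type} [Fintype V] (H : SimpleGraph V) (u₁ v₁ u₂ v₂ a : V)
    (e1 : H.Adj u₁ v₁) (e2 : H.Adj u₂ v₂) (hne : s(u₁, v₁) ≠ s(u₂, v₂))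
    (W' : Set (Sym2 (V ⊕ Fin 3))) (W : Set (Sym2 V))
    (hW : ∀ p q, s(p, q) ∈ W → s(p, q) = s(u₁, v₁) ∨ s(p, q) = s(u₂, v₂) ∨
      s(Sum.inl p, Sum.inl q) ∈ W')
    (h1 : s(u₁, v₁) ∈ W → s(Sum.inr 0, Sum.inl u₁) ∈ W' ∨ s(Sum.inr 0, Sum.inl v₁) ∈ W')
    (h2 : s(u₂, v₂) ∈ W → s(Sum.inr 1, Sum.inl u₂) ∈ W' ∨ s(Sum.inr 1, Sum.inl v₂) ∈ W') :
    phi ((circOpTwo H u₁ v₁ u₂ v₂ a).deleteEdges W') ≤ phi (H.deleteEdges W) + 1 := by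
  refine phi_le _ _ (Sum.inr 2) fun A hx hA => ?_
  refine core_two _ _ A u₁ v₁ u₂ v₂ hne hA ?_ ?_ ?_ hx
  · intro p q h
    rw [deleteEdges_adj, two_ll] at h
    rw [deleteEdges_adj]
    grind
  · intro h0
    have f1 := hA.2 _ h0 (Sum.inl u₁)
    have f2 := hA.2 _ h0 (Sum.inl v₁)
    simp only [deleteEdges_adj, two_0] at f1 f2
    simp only [deleteEdges_adj]
    refine ⟨by grind, by grind, by grind, fun p hp => ?_⟩
    have := (two_0 _ _ _ _ _ _ _).1 hp.1.symm
    grind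
  · intro h0
    have f1 := hA.2 _ h0 (Sum.inl u₂)
    have f2 := hA.2 _ h0 (Sum.inl v₂)
    simp only [deleteEdges_adj, two_1] at f1 f2
    simp only [deleteEdges_adj]
    refine ⟨by grind, by grind, by grind, fun p hp => ?_⟩
    have := (two_1 _ _ _ _ _ _ _).1 hp.1.symm
    grind

lemma two_B {V : Type} [Fintype V] (H : SimpleGraph V) (u₁ v₁ u₂ v₂ a : V)
    (e2 : H.Adj u₂ v₂) (hne : s(u₁, v₁) ≠ s(u₂, v₂))
    (W' : Set (Sym2 (V ⊕ Fin 3)))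
    (hW' : s(Sum.inr 2, Sum.inl a) ∈ W' ∨ s(Sum.inr 2, Sum.inr 1) ∈ W') :
    phi ((circOpTwo H u₁ v₁ u₂ v₂ a).deleteEdges W') ≤
      phi (H.deleteEdges {s(u₁, v₁)}) + 1 := by
  refine phi_le _ _ (Sum.inr 0) fun A hx hA => ?_
  have hx2 : Sum.inr 2 ∉ A := by
    intro h
    have f1 := hA.2 _ h (Sum.inl a)
    have f2 := hA.2 _ h (Sum.inr 1)
    simp only [deleteEdges_adj, two_2] at f1 f2
    grind
  refine core_two _ _ A u₁ v₁ u₂ v₂ hne hA ?_ ?_ ?_ hx2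
  · intro p q h
    rw [deleteEdges_adj, two_ll] at h
    rw [deleteEdges_adj]
    grind
  · exact fun h => absurd h hx
  · intro h0
    have f1 := hA.2 _ h0 (Sum.inl u₂)
    have f2 := hA.2 _ h0 (Sum.inl v₂)
    simp only [deleteEdges_adj, two_1] at f1 f2
    simp only [deleteEdges_adj]
    refine ⟨by grind, by grind, by grind, fun p hp => ?_⟩
    have := (two_1 _ _ _ _ _ _ _).1 hp.1.symm
    grind

lemma two_C {V : Type} [Fintype V] (H : SimpleGraph V) (u₁ v₁ u₂ v₂ a : V)
    (e1 : H.Adj u₁ v₁) (hne : s(u₁, v₁) ≠ s(u₂, v₂))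
    (W' : Set (Sym2 (V ⊕ Fin 3)))
    (hW' : s(Sum.inr 2, Sum.inr 0) ∈ W') :
    phi ((circOpTwo H u₁ v₁ u₂ v₂ a).deleteEdges W') ≤
      phi (H.deleteEdges {s(u₂, v₂)}) + 1 := by
  refine phi_le _ _ (Sum.inr 1) fun A hx hA => ?_
  have hx2 : Sum.inr 2 ∉ A := by
    intro h
    have f1 := hA.2 _ h (Sum.inl a)
    simp only [deleteEdges_adj, two_2] at f1
    grind
  refine core_two _ _ A u₁ v₁ u₂ v₂ hne hA ?_ ?_ ?_ hx2
  · intro p q h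
    rw [deleteEdges_adj, two_ll] at h
    rw [deleteEdges_adj]
    grind
  · intro h0
    have f1 := hA.2 _ h0 (Sum.inl u₁)
    have f2 := hA.2 _ h0 (Sum.inl v₁)
    simp only [deleteEdges_adj, two_0] at f1 f2
    simp only [deleteEdges_adj]
    refine ⟨by grind, by grind, by grind, fun p hp => ?_⟩
    have := (two_0 _ _ _ _ _ _ _).1 hp.1.symm
    grind
  · exact fun h => absurd h hx

lemma one_A {V : Type} [Fintype V] (H : SimpleGraph V) (u v a : V) (e : H.Adj u v)
    (W' : Set (Sym2 (V ⊕ Fin 3))) (W : Set (Sym2 V))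
    (hW : ∀ p q, s(p, q) ∈ W → s(p, q) = s(u, v) ∨ s(Sum.inl p, Sum.inl q) ∈ W')
    (h1 : s(u, v) ∈ W → s(Sum.inr 0, Sum.inl u) ∈ W' ∨ s(Sum.inr 0, Sum.inr 1) ∈ W' ∨
      s(Sum.inr 1, Sum.inl v) ∈ W') :
    phi ((circOpOne H u v a).deleteEdges W') ≤ phi (H.deleteEdges W) + 1 := by
  refine phi_le _ _ (Sum.inr 2) fun A hx hA => ?_
  refine core_one _ _ A u v e.ne hA ?_ ?_ hx
  · intro p q h
    rw [deleteEdges_adj, one_ll] at h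
    rw [deleteEdges_adj]
    grind
  · intro h0
    have f1 := fun h => hA.2 (Sum.inr 0) h (Sum.inl u)
    have f2 := fun h => hA.2 (Sum.inr 0) h (Sum.inr 1)
    have f3 := fun h => hA.2 (Sum.inr 1) h (Sum.inl v)
    have f4 := fun h => hA.2 (Sum.inr 1) h (Sum.inr 0)
    simp only [deleteEdges_adj, one_0, one_1] at f1 f2 f3 f4
    simp only [deleteEdges_adj]
    refine ⟨by grind, by grind, by grind, fun p hp => ?_, fun p hp => ?_⟩
    · have := (one_0 _ _ _ _ _).1 hp.1.symm
      grind
    · have := (one_1 _ _ _ _ _).1 hp.1.symm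
      grind

lemma one_B {V : Type} [Fintype V] (H : SimpleGraph V) (u v a : V) (e : H.Adj u v)
    (W' : Set (Sym2 (V ⊕ Fin 3)))
    (hW' : s(Sum.inr 2, Sum.inl a) ∈ W' ∨ s(Sum.inr 2, Sum.inr 1) ∈ W') :
    phi ((circOpOne H u v a).deleteEdges W') ≤ phi (H.deleteEdges {s(u, v)}) + 1 := by
  refine phi_le _ _ (Sum.inr 0) fun A hx hA => ?_
  have hx2 : Sum.inr 2 ∉ A := by
    intro h
    have f1 := hA.2 _ h (Sum.inl a)
    have f2 := hA.2 _ h (Sum.inr 1)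
    simp only [deleteEdges_adj, one_2] at f1 f2
    grind
  refine core_one _ _ A u v e.ne hA ?_ ?_ hx2
  · intro p q h
    rw [deleteEdges_adj, one_ll] at h
    rw [deleteEdges_adj]
    grind
  · intro h0
    have f3 := fun h => hA.2 (Sum.inr 1) h (Sum.inl v)
    simp only [deleteEdges_adj, one_1] at f3
    grind

lemma one_C {V : Type} [Fintype V] (H : SimpleGraph V) (u v a : V) (e : H.Adj u v)
    (W' : Set (Sym2 (V ⊕ Fin 3)))
    (hW' : s(Sum.inr 2, Sum.inr 0) ∈ W') :
    phi ((circOpOne H u v a).deleteEdges W') ≤ phi (H.deleteEdges {s(u, v)}) + 1 := by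
  refine phi_le _ _ (Sum.inr 1) fun A hx hA => ?_
  have hx2 : Sum.inr 2 ∉ A := by
    intro h
    have f1 := hA.2 _ h (Sum.inl a)
    simp only [deleteEdges_adj, one_2] at f1
    grind
  refine core_one _ _ A u v e.ne hA ?_ ?_ hx2
  · intro p q h
    rw [deleteEdges_adj, one_ll] at h
    rw [deleteEdges_adj]
    grind
  · intro h0
    have f3 := fun h => hA.2 (Sum.inr 0) h (Sum.inl u)
    simp only [deleteEdges_adj, one_0] at f3
    grind

lemma sum_edge_cases {V : Type} (P : Sym2 (V ⊕ Fin 3) → Prop)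
    (hll : ∀ p q, P s(Sum.inl p, Sum.inl q))
    (h0 : ∀ x, P s(Sum.inr 0, x)) (h1 : ∀ x, P s(Sum.inr 1, x)) (h2 : ∀ x, P s(Sum.inr 2, x)) :
    ∀ e, P e := by
  have hr : ∀ i x, P s(Sum.inr i, x) := by
    intro i
    fin_cases i
    exacts [h0, h1, h2]
  intro e
  induction e using Sym2.ind with
  | _ x y =>
    rcases x with p | i
    · rcases y with q | j
      · exact hll p q
      · rw [Sym2.eq_swap]; exact hr _ _
    · exact hr _ _

/-- If `G = H ∘ (e₁, e₂, a)` for a finite simple graph `H`, a degree-two vertex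
`a` and (not necessarily distinct) edges `e₁, e₂` of `H`, `k ∈ {0,1}`, and `φ(H − W) ≤ p` for
every set `W` of edges of `H` with `|W| = k`, then `φ(G − W′) ≤ p + 1` for every set `W′` of
edges of `G` with `|W′| = k`. -/
theorem statement_1 {V : Type} [Fintype V] (H : SimpleGraph V) (k : ℕ) (hk : k = 0 ∨ k = 1)
    (a : V) (ha : HasDegreeTwo H a) (G : SimpleGraph (V ⊕ Fin 3)) (hG : IsCircOp H a G)
    (p : ℝ)
    (hH : ∀ W : Set (Sym2 V), W ⊆ H.edgeSet → W.ncard = k →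
      (phi (H.deleteEdges W) : ℝ) ≤ p) :
    ∀ W' : Set (Sym2 (V ⊕ Fin 3)), W' ⊆ G.edgeSet → W'.ncard = k →
      (phi (G.deleteEdges W') : ℝ) ≤ p + 1 := by
  intro W' hW' hcard
  suffices h : ∃ W : Set (Sym2 V), W ⊆ H.edgeSet ∧ W.ncard = k ∧
      phi (G.deleteEdges W') ≤ phi (H.deleteEdges W) + 1 by
    obtain ⟨W, h1, h2, h3⟩ := h
    have h4 := hH W h1 h2
    have h5 : (phi (G.deleteEdges W') : ℝ) ≤ phi (H.deleteEdges W) + 1 := by exact_mod_cast h3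
    linarith
  rcases hk with rfl | rfl
  · have hW0 : W' = ∅ := (Set.ncard_eq_zero (Set.toFinite _)).1 hcard
    subst hW0
    refine ⟨∅, Set.empty_subset _, Set.ncard_empty _, ?_⟩
    rcases hG with ⟨u₁, v₁, u₂, v₂, e1, e2, hne, rfl⟩ | ⟨u, v, e, rfl⟩
    · exact two_A H u₁ v₁ u₂ v₂ a e1 e2 hne _ _ (by simp) (by simp) (by simp)
    · exact one_A H u v a e _ _ (by simp) (by simp)
  · obtain ⟨e', rfl⟩ := Set.ncard_eq_one.1 hcard
    have he' : e' ∈ G.edgeSet := hW' rfl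
    suffices h : ∃ f ∈ H.edgeSet,
        phi (G.deleteEdges {e'}) ≤ phi (H.deleteEdges {f}) + 1 by
      obtain ⟨f, hf, hle⟩ := h
      exact ⟨{f}, by simpa using hf, Set.ncard_singleton _, hle⟩
    clear hW' hcard hH
    rcases hG with ⟨u₁, v₁, u₂, v₂, e1, e2, hne, rfl⟩ | ⟨u, v, e, rfl⟩
    · have hne' := hne.symm
      revert e'
      refine sum_edge_cases _ ?_ ?_ ?_ ?_
      · intro r q h
        rw [mem_edgeSet, two_ll] at h
        refine ⟨s(r, q), h.1, two_A H u₁ v₁ u₂ v₂ a e1 e2 hne _ _ ?_ ?_ ?_⟩ <;>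
          simp only [Set.mem_singleton_iff] <;> grind
      · intro x h
        rw [mem_edgeSet, two_0] at h
        rcases h with rfl | rfl | rfl
        · exact ⟨s(u₁, v₁), e1, two_A H u₁ v₁ u₂ v₂ a e1 e2 hne _ _ (by simp; grind) (by simp)
            (fun h => absurd h hne')⟩
        · exact ⟨s(u₁, v₁), e1, two_A H u₁ v₁ u₂ v₂ a e1 e2 hne _ _ (by simp; grind) (by simp)
            (fun h => absurd h hne')⟩
        · exact ⟨s(u₂, v₂), e2, two_C H u₁ v₁ u₂ v₂ a e1 hne _ Sym2.eq_swap⟩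
      · intro x h
        rw [mem_edgeSet, two_1] at h
        rcases h with rfl | rfl | rfl
        · exact ⟨s(u₂, v₂), e2, two_A H u₁ v₁ u₂ v₂ a e1 e2 hne _ _ (by simp; grind)
            (fun h => absurd h hne) (by simp)⟩
        · exact ⟨s(u₂, v₂), e2, two_A H u₁ v₁ u₂ v₂ a e1 e2 hne _ _ (by simp; grind)
            (fun h => absurd h hne) (by simp)⟩
        · exact ⟨s(u₁, v₁), e1, two_B H u₁ v₁ u₂ v₂ a e2 hne _ (Or.inr Sym2.eq_swap)⟩
      · intro x h
        rw [mem_edgeSet, two_2] at h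
        rcases h with rfl | rfl | rfl
        · exact ⟨s(u₁, v₁), e1, two_B H u₁ v₁ u₂ v₂ a e2 hne _ (Or.inl rfl)⟩
        · exact ⟨s(u₂, v₂), e2, two_C H u₁ v₁ u₂ v₂ a e1 hne _ rfl⟩
        · exact ⟨s(u₁, v₁), e1, two_B H u₁ v₁ u₂ v₂ a e2 hne _ (Or.inr rfl)⟩
    · revert e'
      refine sum_edge_cases _ ?_ ?_ ?_ ?_
      · intro r q h
        rw [mem_edgeSet, one_ll] at h
        refine ⟨s(r, q), h.1, one_A H u v a e _ _ ?_ ?_⟩ <;>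
          simp only [Set.mem_singleton_iff] <;> grind
      · intro x h
        rw [mem_edgeSet, one_0] at h
        refine ⟨s(u, v), e, ?_⟩
        rcases h with rfl | rfl | rfl
        · exact one_A H u v a e _ _ (by simp) (by simp)
        · exact one_A H u v a e _ _ (by simp) (by simp)
        · exact one_C H u v a e _ Sym2.eq_swap
      · intro x h
        rw [mem_edgeSet, one_1] at h
        refine ⟨s(u, v), e, ?_⟩
        rcases h with rfl | rfl | rfl
        · exact one_A H u v a e _ _ (by simp) (by simp)
        · exact one_A H u v a e _ _ (by simp) (by simp)
        · exact one_B H u v a e _ (Or.inr Sym2.eq_swap)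
      · intro x h
        rw [mem_edgeSet, one_2] at h
        refine ⟨s(u, v), e, ?_⟩
        rcases h with rfl | rfl | rfl
        · exact one_B H u v a e _ (Or.inl rfl)
        · exact one_C H u v a e _ rfl
        · exact one_B H u v a e _ (Or.inr rfl)
end

section
/- Every graph in the family F_{2,2} contains two vertex-disjoint cycles, each of length less than five. -/
open SimpleGraph

/-- A list of three or four distinct vertices forming a cycle. -/
def S7Cyc {V : Type} (R : V → V → Prop) : List V → Prop
  | [x, y, z] => [x, y, z].Nodup ∧ R x y ∧ R y z ∧ R z x
  | [x, y, z, w] => [x, y, z, w].Nodup ∧ R x y ∧ R y z ∧ R z w ∧ R w x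
  | _ => False

instance {V : Type} [DecidableEq V] (R : V → V → Prop) [DecidableRel R] (l : List V) :
    Decidable (S7Cyc R l) := by
  unfold S7Cyc
  split <;> infer_instance

lemma S7Cyc.walk {V : Type} {G : SimpleGraph V} {l : List V} (h : S7Cyc G.Adj l) :
    ∃ (u : V) (c : G.Walk u u), c.IsCycle ∧ c.length < 5 ∧ ∀ x ∈ c.support, x ∈ l := by
  unfold S7Cyc at h
  split at h
  · rename_i x y z
    obtain ⟨hn, h1, h2, h3⟩ := h
    refine ⟨x, .cons h1 (.cons h2 (.cons h3 .nil)), ?_, by simp, by simp⟩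
    rw [Walk.cons_isCycle_iff]
    simp [Walk.cons_isPath_iff] at hn ⊢
    grind
  · rename_i x y z w
    obtain ⟨hn, h1, h2, h3, h4⟩ := h
    refine ⟨x, .cons h1 (.cons h2 (.cons h3 (.cons h4 .nil))), ?_, by simp, by simp⟩
    rw [Walk.cons_isCycle_iff]
    simp [Walk.cons_isPath_iff] at hn ⊢
    grind
  · exact h.elim

lemma S7Cyc.map {V W : Type} {R : V → V → Prop} {S : W → W → Prop} {g : V → W}
    (hg : Function.Injective g) (hR : ∀ x y, R x y → S (g x) (g y)) {l : List V}
    (h : S7Cyc R l) : S7Cyc S (l.map g) := by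
  unfold S7Cyc at h
  split at h
  · exact ⟨h.1.map hg, hR _ _ h.2.1, hR _ _ h.2.2.1, hR _ _ h.2.2.2⟩
  · exact ⟨h.1.map hg, hR _ _ h.2.1, hR _ _ h.2.2.1, hR _ _ h.2.2.2.1, hR _ _ h.2.2.2.2⟩
  · exact h.elim

lemma s7_two {V W : Type} {R : V → V → Prop} {G : SimpleGraph W} {g : V → W}
    (hg : Function.Injective g) (hR : ∀ x y, R x y → G.Adj (g x) (g y)) {l m : List V}
    (hl : S7Cyc R l) (hm : S7Cyc R m) (hd : ∀ x ∈ l, x ∉ m) : HasTwoDisjointShortCycles G := by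
  obtain ⟨u, c, h1, h2, h3⟩ := (hl.map hg hR).walk
  obtain ⟨v, d, k1, k2, k3⟩ := (hm.map hg hR).walk
  refine ⟨u, v, c, d, h1, k1, h2, k2, fun x hx hx' => ?_⟩
  obtain ⟨p, hp, rfl⟩ := List.mem_map.1 (h3 x hx)
  obtain ⟨q, hq, hqp⟩ := List.mem_map.1 (k3 _ hx')
  exact hd p hp (hg hqp ▸ hq)

/-- `K₄` with the edge `01` subdivided by the vertex `4`. -/
def s7E (i j : Fin 5) : Bool :=
  match i.val, j.val with
  | 0, 2 => true | 0, 3 => true | 0, 4 => true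
  | 1, 2 => true | 1, 3 => true | 1, 4 => true
  | 2, 0 => true | 2, 1 => true | 2, 3 => true
  | 3, 0 => true | 3, 1 => true | 3, 2 => true
  | 4, 0 => true | 4, 1 => true
  | _, _ => false

/-- Sameness of unordered pairs. -/
def s7Same (p q u v : Fin 5) : Bool := (p == u && q == v) || (p == v && q == u)

/-- Half of the adjacency of the model of `circOpTwo`. -/
def s7R2 (u₁ v₁ u₂ v₂ : Fin 5) : Fin 5 ⊕ Fin 3 → Fin 5 ⊕ Fin 3 → Bool
  | .inl p, .inl q => s7E p q && !s7Same p q u₁ v₁ && !s7Same p q u₂ v₂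
  | .inr 0, .inl p => p == u₁ || p == v₁
  | .inr 1, .inl p => p == u₂ || p == v₂
  | .inr 2, .inl p => p == 4
  | .inr 2, .inr 0 => true
  | .inr 2, .inr 1 => true
  | _, _ => false

/-- Half of the adjacency of the model of `circOpOne`. -/
def s7R1 (u v : Fin 5) : Fin 5 ⊕ Fin 3 → Fin 5 ⊕ Fin 3 → Bool
  | .inl p, .inl q => s7E p q && !s7Same p q u v
  | .inr 0, .inl p => p == u
  | .inr 0, .inr 1 => true
  | .inr 1, .inl p => p == v
  | .inr 2, .inl p => p == 4
  | .inr 2, .inr 0 => true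
  | .inr 2, .inr 1 => true
  | _, _ => false

/-- Candidate pairs of disjoint short cycles. -/
def s7Cand : List (List (Fin 5 ⊕ Fin 3) × List (Fin 5 ⊕ Fin 3)) :=
  [
    ([.inl 1, .inl 2, .inl 3], [.inl 4, .inr 1, .inr 2]),
    ([.inl 0, .inl 3, .inl 1, .inl 4], [.inr 0, .inr 1, .inr 2]),
    ([.inl 1, .inl 2, .inl 3], [.inl 4, .inr 0, .inr 2]),
    ([.inl 0, .inl 2, .inl 1, .inl 4], [.inl 3, .inr 0, .inr 2, .inr 1]),
    ([.inl 0, .inl 2, .inl 3], [.inl 1, .inr 0, .inr 2, .inr 1]),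
    ([.inl 0, .inl 3, .inl 1, .inl 4], [.inl 2, .inr 0, .inr 2, .inr 1]),
    ([.inl 0, .inl 2, .inl 1, .inl 4], [.inr 0, .inr 1, .inr 2]),
    ([.inl 0, .inl 2, .inr 0, .inl 3], [.inl 4, .inr 1, .inr 2]),
    ([.inl 0, .inl 2, .inr 1, .inl 3], [.inl 4, .inr 0, .inr 2]),
    ([.inl 0, .inr 0, .inr 2, .inr 1], [.inl 1, .inl 2, .inl 3]),
    ([.inl 0, .inl 2, .inl 3], [.inl 1, .inl 4, .inr 2, .inr 0]),
    ([.inl 0, .inl 2, .inl 3], [.inl 4, .inr 0, .inr 2]),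
    ([.inl 0, .inl 3, .inl 2, .inr 0], [.inl 1, .inl 4, .inr 2, .inr 1]),
    ([.inl 0, .inl 3, .inl 2, .inr 1], [.inl 1, .inl 4, .inr 2, .inr 0]),
    ([.inl 0, .inl 2, .inl 3, .inr 1], [.inl 1, .inl 4, .inr 2, .inr 0]),
    ([.inl 0, .inl 2, .inl 3, .inr 0], [.inl 1, .inl 4, .inr 2, .inr 1])
  ]

lemma s7Cand_disj : ∀ c ∈ s7Cand, ∀ x ∈ c.1, x ∉ c.2 := by
  have h : ∀ c ∈ s7Cand, ∀ x ∈ c.1, ∀ y ∈ c.2, x ≠ y := by decide +kernel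
  exact fun c hc x hx hy => h c hc x hx x hy rfl

lemma s7_check2 : ∀ u₁ v₁ u₂ v₂ : Fin 5, s7E u₁ v₁ = true → s7E u₂ v₂ = true →
    s7Same u₁ v₁ u₂ v₂ = false →
    ∃ c ∈ s7Cand,
      S7Cyc (fun x y => (s7R2 u₁ v₁ u₂ v₂ x y || s7R2 u₁ v₁ u₂ v₂ y x) = true) c.1 ∧
      S7Cyc (fun x y => (s7R2 u₁ v₁ u₂ v₂ x y || s7R2 u₁ v₁ u₂ v₂ y x) = true) c.2 := by
  decide +kernel

lemma s7_check1 : ∀ u v : Fin 5, s7E u v = true →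
    ∃ c ∈ s7Cand,
      S7Cyc (fun x y => (s7R1 u v x y || s7R1 u v y x) = true) c.1 ∧
      S7Cyc (fun x y => (s7R1 u v x y || s7R1 u v y x) = true) c.2 := by
  decide +kernel

lemma s7Same_iff {V : Type} {f : Fin 5 → V} (hf : Function.Injective f) (p q u v : Fin 5) :
    s7Same p q u v = true ↔ s(f p, f q) = s(f u, f v) := by
  simp [s7Same, hf.eq_iff]

/-- `H` is isomorphic to the once-subdivided `K₄`. -/
def S7P21 {V : Type} (H : SimpleGraph V) : Prop :=
  ∃ f : Fin 5 → V, Function.Bijective f ∧ ∀ i j, H.Adj (f i) (f j) ↔ s7E i j = true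

/-- `H` is isomorphic to `K₄`. -/
def S7P11 {V : Type} (H : SimpleGraph V) : Prop :=
  ∃ f : Fin 4 → V, Function.Bijective f ∧ ∀ i j, H.Adj (f i) (f j) ↔ i ≠ j

lemma s7E_irrefl : ∀ p, s7E p p = false := by decide

lemma s7_rel2 {V : Type} {H : SimpleGraph V} {f : Fin 5 → V} (hf : Function.Injective f)
    (hE : ∀ i j, H.Adj (f i) (f j) ↔ s7E i j = true) (u₁ v₁ u₂ v₂ : Fin 5)
    (x y : Fin 5 ⊕ Fin 3) (h : s7R2 u₁ v₁ u₂ v₂ x y = true) :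
    (circOpTwo H (f u₁) (f v₁) (f u₂) (f v₂) (f 4)).Adj (Sum.map f id x) (Sum.map f id y) := by
  unfold s7R2 at h
  rw [circOpTwo, SimpleGraph.fromRel_adj]
  split at h
  · rename_i p q
    simp only [Bool.and_eq_true, Bool.not_eq_true', ← Bool.not_eq_true, s7Same_iff hf] at h
    refine ⟨?_, Or.inl (Or.inl ⟨f p, f q, rfl, rfl, (hE p q).2 h.1.1, h.1.2, h.2⟩)⟩
    intro he
    have := hf (Sum.inl.inj he)
    subst this
    simp [s7E_irrefl] at h
  all_goals simp at h
  all_goals simp [hf.eq_iff, h]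

lemma s7_rel1 {V : Type} {H : SimpleGraph V} {f : Fin 5 → V} (hf : Function.Injective f)
    (hE : ∀ i j, H.Adj (f i) (f j) ↔ s7E i j = true) (u v : Fin 5)
    (x y : Fin 5 ⊕ Fin 3) (h : s7R1 u v x y = true) :
    (circOpOne H (f u) (f v) (f 4)).Adj (Sum.map f id x) (Sum.map f id y) := by
  unfold s7R1 at h
  rw [circOpOne, SimpleGraph.fromRel_adj]
  split at h
  · rename_i p q
    simp only [Bool.and_eq_true, Bool.not_eq_true', ← Bool.not_eq_true, s7Same_iff hf] at h
    refine ⟨?_, Or.inl (Or.inl ⟨f p, f q, rfl, rfl, (hE p q).2 h.1, h.2⟩)⟩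
    intro he
    have := hf (Sum.inl.inj he)
    subst this
    simp [s7E_irrefl] at h
  all_goals simp at h
  all_goals simp [hf.eq_iff, h]

lemma s7_deg : ∀ i j k : Fin 5, (∀ z, s7E i z = true → z = j ∨ z = k) → i = 4 := by
  decide +kernel

lemma s7_deg4 : ∀ i j k : Fin 4, ¬ (∀ z, i ≠ z → z = j ∨ z = k) := by
  decide +kernel

lemma S7P11.noDeg {V : Type} {H : SimpleGraph V} (h : S7P11 H) (a : V) : ¬ HasDegreeTwo H a := by
  rintro ⟨x, y, -, -, -, hz⟩
  obtain ⟨f, hf, hE⟩ := h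
  obtain ⟨i, rfl⟩ := hf.2 a
  obtain ⟨j, rfl⟩ := hf.2 x
  obtain ⟨k, rfl⟩ := hf.2 y
  refine s7_deg4 i j k fun z hiz => ?_
  simpa [hf.1.eq_iff] using hz (f z) ((hE _ _).2 hiz)

lemma S7P21.op {V : Type} {H : SimpleGraph V} (h : S7P21 H) {a : V} (ha : HasDegreeTwo H a)
    {G : SimpleGraph (V ⊕ Fin 3)} (hG : IsCircOp H a G) : HasTwoDisjointShortCycles G := by
  obtain ⟨f, hf, hE⟩ := h
  have hinj : Function.Injective (Sum.map f (id : Fin 3 → Fin 3)) :=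
    hf.1.sumMap Function.injective_id
  obtain ⟨i, rfl⟩ := hf.2 a
  have hi : i = 4 := by
    obtain ⟨x, y, -, -, -, hz⟩ := ha
    obtain ⟨j, rfl⟩ := hf.2 x
    obtain ⟨k, rfl⟩ := hf.2 y
    refine s7_deg i j k fun z hiz => ?_
    simpa [hf.1.eq_iff] using hz (f z) ((hE _ _).2 hiz)
  subst hi
  rcases hG with ⟨u₁, v₁, u₂, v₂, h1, h2, h3, rfl⟩ | ⟨u, v, h1, rfl⟩
  · obtain ⟨u₁, rfl⟩ := hf.2 u₁
    obtain ⟨v₁, rfl⟩ := hf.2 v₁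
    obtain ⟨u₂, rfl⟩ := hf.2 u₂
    obtain ⟨v₂, rfl⟩ := hf.2 v₂
    rw [Ne, ← s7Same_iff hf.1, Bool.not_eq_true] at h3
    obtain ⟨c, hc, hl, hm⟩ := s7_check2 u₁ v₁ u₂ v₂ ((hE _ _).1 h1) ((hE _ _).1 h2) h3
    refine s7_two hinj (fun x y hxy => ?_) hl hm (s7Cand_disj c hc)
    rw [Bool.or_eq_true] at hxy
    rcases hxy with hxy | hxy
    · exact s7_rel2 hf.1 hE _ _ _ _ _ _ hxy
    · exact (s7_rel2 hf.1 hE _ _ _ _ _ _ hxy).symm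
  · obtain ⟨u, rfl⟩ := hf.2 u
    obtain ⟨v, rfl⟩ := hf.2 v
    obtain ⟨c, hc, hl, hm⟩ := s7_check1 u v ((hE _ _).1 h1)
    refine s7_two hinj (fun x y hxy => ?_) hl hm (s7Cand_disj c hc)
    rw [Bool.or_eq_true] at hxy
    rcases hxy with hxy | hxy
    · exact s7_rel1 hf.1 hE _ _ _ _ hxy
    · exact (s7_rel1 hf.1 hE _ _ _ _ hxy).symm

lemma s7_others : ∀ i j : Fin 4, i ≠ j → ∃ p q : Fin 4, p ≠ q ∧ p ≠ i ∧ p ≠ j ∧ q ≠ i ∧ q ≠ j ∧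
    ∀ z, z = i ∨ z = j ∨ z = p ∨ z = q := by
  decide +kernel

lemma S7P11.subdiv {V : Type} {H : SimpleGraph V} (h : S7P11 H) {u v : V} (huv : H.Adj u v) :
    S7P21 (subdivideEdge H u v) := by
  obtain ⟨f, hf, hE⟩ := h
  obtain ⟨i, rfl⟩ := hf.2 u
  obtain ⟨j, rfl⟩ := hf.2 v
  have hij := (hE _ _).1 huv
  obtain ⟨p, q, hpq, hpi, hpj, hqi, hqj, hz⟩ := s7_others i j hij
  refine ⟨![some (f i), some (f j), some (f p), some (f q), none], ⟨?_, ?_⟩, ?_⟩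
  · intro x y hxy
    fin_cases x <;> fin_cases y <;> simp [hf.1.eq_iff] at hxy ⊢ <;> grind
  · intro x
    rcases x with _ | x
    · exact ⟨4, rfl⟩
    · obtain ⟨z, rfl⟩ := hf.2 x
      rcases hz z with rfl | rfl | rfl | rfl
      · exact ⟨0, rfl⟩
      · exact ⟨1, rfl⟩
      · exact ⟨2, rfl⟩
      · exact ⟨3, rfl⟩
  · intro x y
    fin_cases x <;> fin_cases y <;>
      simp [subdivideEdge, hf.1.eq_iff, hE, s7E, hpq, hpi, hpj, hqi, hqj, hpq.symm, hpi.symm,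
        hpj.symm, hqi.symm, hqj.symm, hij, hij.symm]

lemma HasTwoDisjointShortCycles.s7iso {V W : Type} {H : SimpleGraph V} {G : SimpleGraph W}
    (e : G ≃g H) (h : HasTwoDisjointShortCycles H) : HasTwoDisjointShortCycles G := by
  obtain ⟨u, v, c, d, h1, h2, h3, h4, h5⟩ := h
  refine ⟨_, _, c.map e.symm.toHom, d.map e.symm.toHom, h1.map e.symm.injective,
    h2.map e.symm.injective, by simpa using h3, by simpa using h4, ?_⟩
  intro x hx hx'
  rw [Walk.support_map, List.mem_map] at hx hx'
  obtain ⟨p, hp, rfl⟩ := hx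
  obtain ⟨q, hq, hqp⟩ := hx'
  have : q = p := e.symm.injective hqp
  subst this
  exact h5 _ hp hq

lemma S7P11.iso {V W : Type} {H : SimpleGraph V} {G : SimpleGraph W}
    (e : G ≃g H) (h : S7P11 H) : S7P11 G := by
  obtain ⟨f, hf, hE⟩ := h
  refine ⟨e.symm ∘ f, e.symm.bijective.comp hf, fun i j => ?_⟩
  rw [← hE]
  exact e.symm.map_adj_iff

lemma S7P21.iso {V W : Type} {H : SimpleGraph V} {G : SimpleGraph W}
    (e : G ≃g H) (h : S7P21 H) : S7P21 G := by
  obtain ⟨f, hf, hE⟩ := h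
  refine ⟨e.symm ∘ f, e.symm.bijective.comp hf, fun i j => ?_⟩
  rw [← hE]
  exact e.symm.map_adj_iff

/-- The invariant for the induction. -/
def S7Q (i j : ℕ) {V : Type} (G : SimpleGraph V) : Prop :=
  i ≠ 0 ∧ (j = 0 → 3 ≤ i) ∧ ¬ (i = 1 ∧ j = 2) ∧ (i = 1 → j = 1 → S7P11 G) ∧
    (i = 2 → j = 1 → S7P21 G) ∧ (i = 2 → j = 2 → HasTwoDisjointShortCycles G)

lemma s7_main {i j : ℕ} {V : Type} {G : SimpleGraph V} (h : IsInF i j G) : S7Q i j G := by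
  induction h with
  | cycle i hi => exact ⟨by omega, by omega, by omega, by omega, by omega, by omega⟩
  | k4 =>
    exact ⟨by omega, by omega, by omega,
      fun _ _ => ⟨id, Function.bijective_id, fun i j => by simp⟩, by omega, by omega⟩
  | subdiv huv hH ih =>
    obtain ⟨h1, h2, h3, h4, h5, h6⟩ := ih
    refine ⟨by omega, by omega, by omega, by omega, ?_, by omega⟩
    intro hi hj
    exact (h4 (by omega) hj).subdiv huv
  | op ha hG hH ih =>
    obtain ⟨h1, h2, h3, h4, h5, h6⟩ := ih
    refine ⟨by omega, by omega, ?_, by omega, by omega, ?_⟩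
    · rintro ⟨hi, hj⟩
      exact (h4 hi (by omega)).noDeg _ ha
    · intro hi hj
      exact (h5 hi (by omega)).op ha hG
  | iso e hH ih =>
    obtain ⟨h1, h2, h3, h4, h5, h6⟩ := ih
    obtain ⟨e⟩ := e
    exact ⟨h1, h2, h3, fun hi hj => (h4 hi hj).iso e, fun hi hj => (h5 hi hj).iso e,
      fun hi hj => (h6 hi hj).s7iso e⟩

/-- Every graph in `F_{2,2}` contains two vertex-disjoint cycles, each of
length less than five. -/
theorem statement_7 {V : Type} (G : SimpleGraph V) (hG : IsInF 2 2 G) :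
    HasTwoDisjointShortCycles G := by
  exact (s7_main hG).2.2.2.2.2 rfl rfl
end
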